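/- If G and H are non-trivial generalized complete graphs, then μt(G □ H) ≤ (n(G) − 1)(n(H) − 1), where n(G) and n(H) denote the orders of G and H. Moreover, equality holds if and only if G or H is isomorphic to a star K_{1,k} for some k ≥ 2. -/

import Mathlib

open SimpleGraph

/-- `X` is a total mutual-visibility set of `G`: every pair of vertices `x, y` admits a
shortest `x,y`-path whose vertices in `X` are among `{x, y}`. -/
def IsTotalMVSet {V : Type*} (G : SimpleGraph V) (X : Set V) : Prop :=
  ∀ x y : V, ∃ p : G.Walk x y, p.IsPath ∧ p.length = G.dist x y ∧
    ∀ z ∈ p.support, z ∈ X → z = x ∨ z = y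

/-- The total mutual-visibility number of `G`. -/
noncomputable def totalMVNum {V : Type*} (G : SimpleGraph V) : ℕ :=
  sSup {n : ℕ | ∃ X : Set V, IsTotalMVSet G X ∧ X.ncard = n}

/-- `S` is an independent set of `G`. -/
def IsIndepVSet {V : Type*} (G : SimpleGraph V) (S : Set V) : Prop :=
  ∀ x ∈ S, ∀ y ∈ S, ¬ G.Adj x y

/-- The independent total mutual-visibility number of `G`. -/
noncomputable def indepTotalMVNum {V : Type*} (G : SimpleGraph V) : ℕ :=
  sSup {n : ℕ | ∃ X : Set V, IsTotalMVSet G X ∧ IsIndepVSet G X ∧ X.ncard = n}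

/-- `u` is a bypass vertex of `G` if it is not the middle vertex of a convex path of
length 2, i.e. there are no vertices `x ≠ y` with `x, y` nonadjacent and `u` their unique
common neighbour. -/
def IsBypassVertex {V : Type*} (G : SimpleGraph V) (u : V) : Prop :=
  ¬ ∃ x y : V, x ≠ y ∧ ¬ G.Adj x y ∧ G.Adj x u ∧ G.Adj u y ∧
      ∀ w : V, G.Adj x w → G.Adj w y → w = u

/-- The number of bypass vertices of `G`. -/
noncomputable def bpNum {V : Type*} (G : SimpleGraph V) : ℕ :=
  {u : V | IsBypassVertex G u}.ncard

/-- `G` is a generalized complete graph: it has a universal vertex whose removal leaves a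
disjoint union of `k ≥ 1` complete graphs; it is non-trivial when `k ≥ 2`, i.e. when two
vertices distinct from the universal vertex are nonadjacent. -/
def IsNontrivialGenCompleteGraph {V : Type*} (G : SimpleGraph V) : Prop :=
  ∃ v : V, (∀ w : V, w ≠ v → G.Adj v w) ∧
    (∀ a b c : V, a ≠ v → b ≠ v → c ≠ v → a ≠ c → G.Adj a b → G.Adj b c → G.Adj a c) ∧
    ∃ a b : V, a ≠ v ∧ b ≠ v ∧ a ≠ b ∧ ¬ G.Adj a b

/-- `G` is isomorphic to a star `K_{1,k}` for some `k ≥ 2`. -/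
def IsStarGraph {V : Type*} (G : SimpleGraph V) : Prop :=
  ∃ k : ℕ, 2 ≤ k ∧ Nonempty (G ≃g completeBipartiteGraph (Fin 1) (Fin k))

namespace SimpleGraph.Walk

variable {V W : Type*} {G : SimpleGraph V} {H : SimpleGraph W}

theorem length_boxProdLeft {a b : V} (h : W) (p : G.Walk a b) :
    (p.boxProdLeft H h).length = p.length :=
  length_map _ p

theorem length_boxProdRight {a b : W} (g : V) (p : H.Walk a b) :
    (p.boxProdRight G g).length = p.length :=
  length_map _ p

theorem support_boxProdLeft {a b : V} (h : W) (p : G.Walk a b) :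
    (p.boxProdLeft H h).support = p.support.map (·, h) :=
  support_map _ p

theorem support_boxProdRight {a b : W} (g : V) (p : H.Walk a b) :
    (p.boxProdRight G g).support = p.support.map (Prod.mk g) :=
  support_map _ p

end SimpleGraph.Walk

namespace IsTotalMVSet

variable {V W : Type*} {G : SimpleGraph V} {H : SimpleGraph W}

theorem ncard_le_totalMVNum [Finite V] {X : Set V} (hX : IsTotalMVSet G X) :
    X.ncard ≤ totalMVNum G := by
  refine le_csSup ⟨Nat.card V, ?_⟩ ⟨X, hX, rfl⟩
  rintro _ ⟨Y, -, rfl⟩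
  exact Set.ncard_le_card Y

theorem exists_ncard_eq [Finite V] (hG : G.Connected) :
    ∃ X : Set V, IsTotalMVSet G X ∧ X.ncard = totalMVNum G := by
  refine Nat.sSup_mem (s := {n : ℕ | ∃ X : Set V, IsTotalMVSet G X ∧ X.ncard = n})
    ⟨0, ∅, fun x y => ?_, Set.ncard_empty V⟩ ⟨Nat.card V, ?_⟩
  · obtain ⟨p, hp, hd⟩ := hG.exists_path_of_dist x y
    exact ⟨p, hp, hd, fun z _ hz => hz.elim⟩
  · rintro _ ⟨Y, -, rfl⟩
    exact Set.ncard_le_card Y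

/-- Two vertices at distance two have a common neighbour outside a total
mutual-visibility set. -/
theorem exists_common_neighbor_notMem {X : Set V} (hX : IsTotalMVSet G X) {x y u : V}
    (hxy : x ≠ y) (hn : ¬ G.Adj x y) (hxu : G.Adj x u) (huy : G.Adj u y) :
    ∃ z, G.Adj x z ∧ G.Adj z y ∧ z ∉ X := by
  obtain ⟨p, -, hd, hs⟩ := hX x y
  have hle : p.length ≤ 2 := hd ▸ dist_le (Walk.cons hxu (Walk.cons huy Walk.nil))
  match p, hle, hs with
  | .nil, _, _ => exact absurd rfl hxy
  | .cons h .nil, _, _ => exact absurd h hn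
  | .cons (v := z) h (.cons h' .nil), _, hs =>
    refine ⟨z, h, h', fun hz => ?_⟩
    rcases hs z (by simp) hz with rfl | rfl
    · exact G.irrefl h
    · exact G.irrefl h'
  | .cons _ (.cons _ (.cons _ _)), hle, _ => simp at hle

theorem image {X : Set V} (hX : IsTotalMVSet G X) (e : G ≃g H) : IsTotalMVSet H (e '' X) := by
  intro x y
  obtain ⟨x, rfl⟩ := e.surjective x
  obtain ⟨y, rfl⟩ := e.surjective y
  obtain ⟨p, -, hd, hs⟩ := hX x y
  have hlen : (p.map e.toHom).length = H.dist (e x) (e y) := by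
    refine le_antisymm ?_ (dist_le _)
    obtain ⟨q, hq⟩ := Reachable.exists_walk_length_eq_dist ⟨p.map e.toHom⟩
    have := dist_le ((q.map e.symm.toHom).copy (e.symm_apply_apply x) (e.symm_apply_apply y))
    rw [Walk.length_copy, Walk.length_map] at this
    rw [Walk.length_map, hd]
    exact this.trans hq.le
  refine ⟨p.map e.toHom, Walk.isPath_of_length_eq_dist _ hlen, hlen, ?_⟩
  rintro _ hz ⟨z, hzX, rfl⟩
  rw [Walk.support_map, List.mem_map] at hz
  obtain ⟨z', hz', h⟩ := hz
  obtain rfl : z' = z := e.injective h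
  exact (hs z' hz' hzX).imp (congrArg e) (congrArg e)

end IsTotalMVSet

theorem totalMVNum_le_of_iso {V W : Type*} [Finite V] [Finite W] {G : SimpleGraph V}
    {H : SimpleGraph W} (hG : G.Connected) (e : G ≃g H) : totalMVNum G ≤ totalMVNum H := by
  obtain ⟨X, hX, hc⟩ := IsTotalMVSet.exists_ncard_eq hG
  rw [← hc, ← Set.ncard_image_of_injective X e.injective]
  exact (hX.image e).ncard_le_totalMVNum

section UniversalVertex

variable {V W : Type*} {G : SimpleGraph V} {H : SimpleGraph W}

/-- A universal vertex `v` of `G` makes every vertex `(v, h)` of `G □ H` lie outside of each total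
mutual-visibility set, provided `v` is the only common neighbour of some two vertices. -/
theorem IsTotalMVSet.fst_ne {X : Set (V × W)} (hX : IsTotalMVSet (G □ H) X) {v a b : V}
    (hv : ∀ w, w ≠ v → G.Adj v w)
    (ht : ∀ a b c : V, a ≠ v → b ≠ v → c ≠ v → a ≠ c → G.Adj a b → G.Adj b c → G.Adj a c)
    (ha : a ≠ v) (hb : b ≠ v) (hab : a ≠ b) (hn : ¬ G.Adj a b) {z : V × W} (hz : z ∈ X) :
    z.1 ≠ v := by
  obtain ⟨g, h⟩ := z
  rintro rfl
  obtain ⟨⟨c, d⟩, h1, h2, h3⟩ := hX.exists_common_neighbor_notMem (x := (a, h)) (y := (b, h))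
    (u := (g, h)) (by simpa using hab) (by simpa using hn) (by simpa using (hv a ha).symm)
    (by simpa using hv b hb)
  simp only [boxProd_adj] at h1 h2
  rcases h1 with ⟨h1, rfl⟩ | ⟨h1, rfl⟩
  · rcases h2 with ⟨h2, -⟩ | ⟨h2, -⟩
    · refine hn (ht a c b ha ?_ hb hab h1 h2)
      rintro rfl
      exact h3 hz
    · exact H.irrefl h2
  · rcases h2 with ⟨-, rfl⟩ | ⟨-, h2⟩
    · exact H.irrefl h1
    · exact hab h2

theorem IsTotalMVSet.notMem_or_notMem {X : Set (V × W)} (hX : IsTotalMVSet (G □ H) X)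
    {a b : V} {c d : W} (hab : G.Adj a b) (hcd : H.Adj c d) : (a, d) ∉ X ∨ (b, c) ∉ X := by
  obtain ⟨⟨s, t⟩, h1, h2, h3⟩ := hX.exists_common_neighbor_notMem (x := (a, c)) (y := (b, d))
    (u := (a, d)) (by simp [hab.ne]) (by simp [hab.ne, hcd.ne]) (by simpa using hcd)
    (by simpa using hab)
  simp only [boxProd_adj] at h1 h2
  rcases h1 with ⟨h1, rfl⟩ | ⟨h1, rfl⟩
  · rcases h2 with ⟨-, rfl⟩ | ⟨-, rfl⟩
    · exact absurd rfl hcd.ne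
    · exact Or.inr h3
  · rcases h2 with ⟨-, rfl⟩ | ⟨-, rfl⟩
    · exact Or.inl h3
    · exact absurd rfl hab.ne

theorem exists_walk_to_universal {v : V} (hv : ∀ w, w ≠ v → G.Adj v w) (a : V) :
    ∃ p : G.Walk a v, p.length = G.dist a v ∧ ∀ z ∈ p.support, z = a ∨ z = v := by
  by_cases ha : a = v
  · subst ha
    exact ⟨Walk.nil, by simp, by simp⟩
  · have h := (hv a ha).symm
    exact ⟨h.toWalk, by simp [dist_eq_one_iff_adj.2 h], by simp⟩

theorem exists_geodesic_via_universal (hG : G.Connected) {v : V} (hv : ∀ w, w ≠ v → G.Adj v w)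
    (a b : V) :
    ∃ p : G.Walk a b, p.length = G.dist a b ∧ ∀ z ∈ p.support, z = a ∨ z = b ∨ z = v := by
  by_cases hab : a = b
  · subst hab
    exact ⟨Walk.nil, by simp, by simp⟩
  by_cases h : G.Adj a b
  · exact ⟨h.toWalk, by simp [dist_eq_one_iff_adj.2 h], by simp⟩
  obtain ⟨p, hp, hps⟩ := exists_walk_to_universal hv a
  obtain ⟨q, hq, hqs⟩ := exists_walk_to_universal hv b
  refine ⟨p.append q.reverse, le_antisymm ?_ (dist_le _), fun z hz => ?_⟩
  · have h1 := hG.one_lt_dist_of_ne_of_not_adj hab h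
    have hle : ∀ c, G.dist c v ≤ 1 := fun c => by
      by_cases hc : c = v
      · simp [hc]
      · exact (dist_eq_one_iff_adj.2 (hv c hc).symm).le
    have := hle a
    have := hle b
    rw [Walk.length_append, Walk.length_reverse]
    omega
  · rw [Walk.mem_support_append_iff, Walk.support_reverse, List.mem_reverse] at hz
    rcases hz with hz | hz
    · have := hps z hz; tauto
    · have := hqs z hz; tauto

theorem dist_boxProd_of_connected (hG : G.Connected) (hH : H.Connected) (x y : V × W) :
    (G □ H).dist x y = G.dist x.1 y.1 + H.dist x.2 y.2 := by
  have h := edist_boxProd (G := G) (H := H) x y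
  rw [← (hG x.1 y.1).coe_dist_eq_edist, ← (hH x.2 y.2).coe_dist_eq_edist,
    ← ((hG.boxProd hH) x y).coe_dist_eq_edist] at h
  exact_mod_cast h

/-- If `G` is a star with centre `v` and `w` is universal in `H`, the vertices of `G □ H` outside
the two layers through `v` and `w` form a total mutual-visibility set. -/
theorem isTotalMVSet_boxProd_of_star (hG : G.Connected) (hH : H.Connected) {v : V} {w : W}
    (hv : ∀ u, u ≠ v → G.Adj v u) (hw : ∀ u, u ≠ w → H.Adj w u)
    (hs : ∀ a b, a ≠ v → b ≠ v → ¬ G.Adj a b) :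
    IsTotalMVSet (G □ H) ({v}ᶜ ×ˢ {w}ᶜ) := by
  suffices key : ∀ x y : V × W, ∃ p : (G □ H).Walk x y, p.length = (G □ H).dist x y ∧
      ∀ z ∈ p.support, z ∈ ({v}ᶜ ×ˢ {w}ᶜ : Set (V × W)) → z = x ∨ z = y by
    intro x y
    obtain ⟨p, hp, h⟩ := key x y
    exact ⟨p, p.isPath_of_length_eq_dist hp, hp, h⟩
  rintro ⟨a, h⟩ ⟨b, h'⟩
  rw [dist_boxProd_of_connected hG hH]
  obtain ⟨q, hq, hqs⟩ := exists_geodesic_via_universal hH hw h h'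
  by_cases hab : a = b
  · subst hab
    refine ⟨q.boxProdRight G a, ?_, ?_⟩
    · rw [Walk.length_boxProdRight, hq]
      simp
    · rintro z hz ⟨-, hz2⟩
      rw [Walk.support_boxProdRight, List.mem_map] at hz
      obtain ⟨c, hc, rfl⟩ := hz
      have := hqs c hc
      simp at hz2 ⊢
      tauto
  · obtain ⟨p, hp, hps⟩ := exists_walk_to_universal hv a
    obtain ⟨r, hr, hrs⟩ := exists_walk_to_universal hv b
    refine ⟨(p.boxProdLeft H h).append
      ((q.boxProdRight G v).append (r.reverse.boxProdLeft H h')), ?_, ?_⟩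
    · have hd : G.dist a v + G.dist b v = G.dist a b := by
        by_cases ha : a = v
        · simp [ha, SimpleGraph.dist_comm]
        by_cases hb : b = v
        · simp [hb]
        have h1 := hG.one_lt_dist_of_ne_of_not_adj hab (hs a b ha hb)
        have h2 := dist_eq_one_iff_adj.2 (hv a ha).symm
        have h3 := dist_eq_one_iff_adj.2 (hv b hb).symm
        have h4 := hG.dist_triangle (u := a) (v := v) (w := b)
        rw [SimpleGraph.dist_comm (u := v)] at h4
        omega
      simp only [Walk.length_append, Walk.length_boxProdLeft, Walk.length_boxProdRight,
        Walk.length_reverse]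
      omega
    · rintro z hz ⟨hz1, -⟩
      simp only [Walk.mem_support_append_iff, Walk.support_boxProdLeft,
        Walk.support_boxProdRight, Walk.support_reverse, List.mem_map, List.mem_reverse] at hz
      rcases hz with ⟨c, hc, rfl⟩ | ⟨c, hc, rfl⟩ | ⟨c, hc, rfl⟩
      · have := hps c hc
        simp at hz1 ⊢
        tauto
      · simp at hz1
      · have := hrs c hc
        simp at hz1 ⊢
        tauto

theorem ncard_compl_prod_compl [Fintype V] [Fintype W] (v : V) (w : W) :
    ({v}ᶜ ×ˢ {w}ᶜ : Set (V × W)).ncard = (Fintype.card V - 1) * (Fintype.card W - 1) := by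
  rw [Set.ncard_prod, Set.ncard_compl, Set.ncard_compl, Set.ncard_singleton, Set.ncard_singleton,
    Nat.card_eq_fintype_card, Nat.card_eq_fintype_card]

theorem le_totalMVNum_boxProd_of_star [Fintype V] [Fintype W] (hG : G.Connected)
    (hH : H.Connected) {v : V} {w : W} (hv : ∀ u, u ≠ v → G.Adj v u)
    (hw : ∀ u, u ≠ w → H.Adj w u) (hs : ∀ a b, a ≠ v → b ≠ v → ¬ G.Adj a b) :
    (Fintype.card V - 1) * (Fintype.card W - 1) ≤ totalMVNum (G □ H) :=
  ncard_compl_prod_compl v w ▸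
    (isTotalMVSet_boxProd_of_star hG hH hv hw hs).ncard_le_totalMVNum

theorem isStarGraph_iff_of_universal [Fintype V] {v a b : V} (hv : ∀ u, u ≠ v → G.Adj v u)
    (ha : a ≠ v) (hb : b ≠ v) (hab : a ≠ b) :
    IsStarGraph G ↔ ∀ c d, c ≠ v → d ≠ v → ¬ G.Adj c d := by
  classical
  constructor
  · rintro ⟨k, -, ⟨e⟩⟩ c d hc hd h
    have h1 := e.map_rel_iff.2 h
    have h2 := e.map_rel_iff.2 (hv c hc)
    have h3 := e.map_rel_iff.2 (hv d hd)
    revert h1 h2 h3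
    rcases e c with i | i <;> rcases e d with j | j <;> rcases e v with l | l <;>
      simp [completeBipartiteGraph]
  · intro hs
    let f : {u // u ≠ v} ≃ Fin (Fintype.card {u // u ≠ v}) := Fintype.equivFin _
    let g : {u // u = v} ≃ Fin 1 := Equiv.ofUnique _ _
    let e : V ≃ Fin 1 ⊕ Fin (Fintype.card {u // u ≠ v}) :=
      (Equiv.sumCompl (· = v)).symm.trans (Equiv.sumCongr g f)
    refine ⟨Fintype.card {u // u ≠ v}, ?_, ⟨⟨e, ?_⟩⟩⟩
    · exact Fintype.one_lt_card_iff.2 ⟨⟨a, ha⟩, ⟨b, hb⟩, by simpa using hab⟩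
    · intro c d
      by_cases hc : c = v <;> by_cases hd : d = v
      · simp [e, hc, hd, completeBipartiteGraph]
      · subst hc
        simp [e, hd, completeBipartiteGraph, hv]
      · subst hd
        simp [e, hc, completeBipartiteGraph, (hv _ hc).symm]
      · simp [e, hc, hd, completeBipartiteGraph, hs]

end UniversalVertex

/-- If `G` and `H` are non-trivial generalized complete graphs, then
`μt(G □ H) ≤ (n(G) − 1)(n(H) − 1)`, with equality iff `G` or `H` is a star. -/
theorem totalMVNum_boxProd_genComplete {V W : Type*} [Fintype V] [Fintype W]
    (G : SimpleGraph V) (H : SimpleGraph W) (hG : G.Connected) (hH : H.Connected)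
    (hGgen : IsNontrivialGenCompleteGraph G) (hHgen : IsNontrivialGenCompleteGraph H) :
    totalMVNum (G □ H) ≤ (Fintype.card V - 1) * (Fintype.card W - 1) ∧
      (totalMVNum (G □ H) = (Fintype.card V - 1) * (Fintype.card W - 1) ↔
        IsStarGraph G ∨ IsStarGraph H) := by
  obtain ⟨v, hv, htv, a, b, ha, hb, hab, hn⟩ := hGgen
  obtain ⟨w, hw, htw, c, d, hc, hd, hcd, hm⟩ := hHgen
  rw [isStarGraph_iff_of_universal hv ha hb hab, isStarGraph_iff_of_universal hw hc hd hcd]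
  obtain ⟨X, hX, hXc⟩ := IsTotalMVSet.exists_ncard_eq (hG.boxProd hH)
  have hsub : X ⊆ {v}ᶜ ×ˢ {w}ᶜ := fun z hz =>
    ⟨hX.fst_ne hv htv ha hb hab hn hz, (hX.image (boxProdComm G H)).fst_ne hw htw hc hd hcd hm
      (Set.mem_image_of_mem _ hz)⟩
  have hle : totalMVNum (G □ H) ≤ (Fintype.card V - 1) * (Fintype.card W - 1) := by
    rw [← hXc, ← ncard_compl_prod_compl v w]
    exact Set.ncard_le_ncard hsub
  refine ⟨hle, fun heq => ?_, fun h => hle.antisymm ?_⟩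
  · by_contra! hcon
    obtain ⟨⟨s, t, hs, ht, hst⟩, ⟨i, j, hi, hj, hij⟩⟩ := hcon
    rw [← hXc, ← ncard_compl_prod_compl v w] at heq
    have hXeq := Set.eq_of_subset_of_ncard_le hsub heq.ge
    rcases hX.notMem_or_notMem hst hij with h | h
    · exact h (hXeq ▸ ⟨hs, hj⟩)
    · exact h (hXeq ▸ ⟨ht, hi⟩)
  · rcases h with h | h
    · exact le_totalMVNum_boxProd_of_star hG hH hv hw h
    · rw [mul_comm]
      exact (le_totalMVNum_boxProd_of_star hH hG hw hv h).trans
        (totalMVNum_le_of_iso (hH.boxProd hG) (boxProdComm H G))
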